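/- arXiv:1910.03426 — 2 statements merged into one kernel-verified Lean document; each statement's English description precedes it below -/
import Mathlib

section
/- Let X be a continuous vector field on ℝⁿ, θ a smooth 1-form, Z a smooth vector field, and let ι(X)_ε(x) = ∫ Υ_ε(x,y) X(y) ω_{x,ε}(y) dy be the smoothed embedding with an admissible net of transport operators and a delta net of smoothing kernels. Then the scalar nets ℒ_Z(ι(X)_εᵃ θ_a) converge in the sense of distributions (ℒ at the classical level on the smooth net) to the distributional Lie derivative ℒ_Z(Xᵃ θ_a): for every compactly supported smooth density μ, lim_{ε→0} ∫ ℒ_Z(ι(X)_εᵃ θ_a) μ = ⟨ℒ_Z(Xᵃ θ_a), μ⟩ = −∫ Xᵃ θ_a ℒ_Z μ. -/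
/- STATEMENT 10: For a continuous vector field X on ℝⁿ, a smooth 1-form θ, a smooth
vector field Z, and the smoothed embedding ι(X)_ε(x) = ∫ Υ_ε(x,y) X(y) ω_{x,ε}(y) dy
(admissible transport operators, delta-net kernels ω_{x,ε}(y) = ε^{−n}φ((y−x)/ε)),
the classical Lie derivatives ℒ_Z(ι(X)_εᵃ θ_a) converge distributionally to the
distributional Lie derivative ℒ_Z(Xᵃθ_a): for every compactly supported smooth
density μ, lim_{ε→0⁺} ∫ ℒ_Z(ι(X)_εᵃ θ_a) μ = ⟨ℒ_Z(Xᵃθ_a), μ⟩ = −∫ Xᵃθ_a ℒ_Z μ. -/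

open MeasureTheory Filter Set Topology

attribute [local instance] Matrix.normedAddCommGroup Matrix.normedSpace

abbrev Rn (n : ℕ) := Fin n → ℝ

noncomputable def pd {n : ℕ} (c : Fin n) (f : Rn n → ℝ) : Rn n → ℝ :=
  fun x => fderiv ℝ f x (Pi.single c 1)

/-- Classical Lie derivative of a scalar field: `ℒ_Z f = Z^c ∂_c f`. -/
noncomputable def lieScal {n : ℕ} (Z : Rn n → Rn n) (f : Rn n → ℝ) : Rn n → ℝ :=
  fun x => ∑ c, Z x c * pd c f x

/-- Lie derivative of a scalar density: `ℒ_Z μ = Z^c ∂_c μ + (∂_c Z^c) μ`. -/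
noncomputable def lieScalDens {n : ℕ} (Z : Rn n → Rn n) (μ : Rn n → ℝ) : Rn n → ℝ :=
  fun x => (∑ c, Z x c * pd c μ x) + (∑ c, pd c (fun y => Z y c) x) * μ x

/-- The smoothed embedding of a vector field via transport operator and kernel. -/
noncomputable def embedVec {n : ℕ} (φ : Rn n → ℝ)
    (Υ : ℝ → Rn n → Rn n → Matrix (Fin n) (Fin n) ℝ) (X : Rn n → Rn n)
    (ε : ℝ) (x : Rn n) : Rn n :=
  ∫ y : Rn n, ((ε ^ n)⁻¹ * φ (ε⁻¹ • (y - x))) • (Υ ε x y).mulVec (X y)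

/-- Matrix-vector multiplication as a continuous bilinear map. -/
noncomputable def mvL (n : ℕ) : (Fin n → Fin n → ℝ) →L[ℝ] Rn n →L[ℝ] Rn n :=
  LinearMap.toContinuousLinearMap
    ((LinearMap.toContinuousLinearMap : (Rn n →ₗ[ℝ] Rn n) ≃ₗ[ℝ] (Rn n →L[ℝ] Rn n)).toLinearMap ∘ₗ
      ((Matrix.mulVecBilin ℝ ℝ : Matrix (Fin n) (Fin n) ℝ →ₗ[ℝ] Rn n →ₗ[ℝ] Rn n) ∘ₗ
        (Matrix.ofLinearEquiv ℝ).toLinearMap))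

lemma mvL_apply {n : ℕ} (M : Fin n → Fin n → ℝ) (v : Rn n) :
    mvL n M v = (Matrix.of M).mulVec v := rfl

lemma mulVec_norm_le {n : ℕ} (M : Matrix (Fin n) (Fin n) ℝ) (v : Rn n) :
    ‖M.mulVec v‖ ≤ ‖mvL n‖ * ‖M‖ * ‖v‖ :=
  (mvL n).le_opNorm₂ (fun i j => M i j) v

lemma mvL_tendsto {n : ℕ} {l : Filter ℝ} {A : ℝ → Fin n → Fin n → ℝ} {A₀ : Fin n → Fin n → ℝ}
    {v : ℝ → Rn n} {v₀ : Rn n} (hA : Tendsto A l (𝓝 A₀)) (hv : Tendsto v l (𝓝 v₀)) :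
    Tendsto (fun t => mvL n (A t) (v t)) l (𝓝 (mvL n A₀ v₀)) := by
  have c : Continuous (fun p : (Fin n → Fin n → ℝ) × Rn n => mvL n p.1 p.2) := by fun_prop
  have c' := c.tendsto (A₀, v₀)
  generalize mvL n = L at c c' ⊢
  exact Tendsto.comp (f := fun t => (A t, v t)) c' (hA.prodMk_nhds hv)

lemma embedVec_subst {n : ℕ} (φ : Rn n → ℝ)
    (Υ : ℝ → Rn n → Rn n → Matrix (Fin n) (Fin n) ℝ) (X : Rn n → Rn n)
    (ε : ℝ) (hε : 0 < ε) (x : Rn n) :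
    embedVec φ Υ X ε x = ∫ z : Rn n, φ z • (Υ ε x (x + ε • z)).mulVec (X (x + ε • z)) := by
  have h1 : embedVec φ Υ X ε x = ∫ y : Rn n, (fun w => ((ε ^ n)⁻¹ * φ (ε⁻¹ • w)) •
      (Υ ε x (x + w)).mulVec (X (x + w))) (y - x) := by
    simp [embedVec]
  rw [h1, integral_sub_right_eq_self (fun w => ((ε ^ n)⁻¹ * φ (ε⁻¹ • w)) •
      (Υ ε x (x + w)).mulVec (X (x + w))) x]
  have h2 := MeasureTheory.Measure.integral_comp_inv_smul_of_nonneg (volume : Measure (Rn n))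
    (fun z : Rn n => φ z • (Υ ε x (x + ε • z)).mulVec (X (x + ε • z))) hε.le
  simp only [smul_inv_smul₀ hε.ne', Module.finrank_fin_fun] at h2
  simp only [mul_smul]
  rw [integral_smul, h2, inv_smul_smul₀ (pow_ne_zero _ hε.ne')]

lemma embedVec_contDiff {n : ℕ} (φ : Rn n → ℝ) (hφsm : ContDiff ℝ (⊤ : ℕ∞) φ)
    (hφc : HasCompactSupport φ)
    (Υ : ℝ → Rn n → Rn n → Matrix (Fin n) (Fin n) ℝ)
    (hΥsm : ∀ ε : ℝ, 0 < ε → ContDiff ℝ (⊤ : ℕ∞) (fun p : Rn n × Rn n => Υ ε p.1 p.2))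
    (X : Rn n → Rn n) (hX : Continuous X) (ε : ℝ) (hε : 0 < ε) :
    ContDiff ℝ (⊤ : ℕ∞) (embedVec φ Υ X ε) := by
  let U : Rn n × Rn n → Fin n → Fin n → ℝ := fun p i j => Υ ε p.1 p.2 i j
  have hU : ContDiff ℝ (⊤ : ℕ∞) U := hΥsm ε hε
  let g : Rn n → Rn n → Fin n → Fin n → ℝ :=
    fun p w => ((ε ^ n)⁻¹ * φ (ε⁻¹ • (-w))) • U (p, p - w)
  have hg : ContDiff ℝ (⊤ : ℕ∞) (Function.uncurry g) := by
    have h1 : ContDiff ℝ (⊤ : ℕ∞) (fun q : Rn n × Rn n => φ (ε⁻¹ • (-q.2))) :=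
      hφsm.comp (by fun_prop)
    have h2 : ContDiff ℝ (⊤ : ℕ∞) (fun q : Rn n × Rn n => U (q.1, q.1 - q.2)) :=
      hU.comp (f := fun q : Rn n × Rn n => (q.1, q.1 - q.2)) (by fun_prop)
    exact (contDiff_const.mul h1).smul h2
  have hk : IsCompact ((fun z : Rn n => -(ε • z)) '' tsupport φ) :=
    IsCompact.image hφc (by fun_prop)
  have key := contDiffOn_convolution_right_with_param_comp (μ := (volume : Measure (Rn n)))
    (n := (⊤ : ℕ∞)) (mvL n).flip (s := univ) (v := fun x => x) contDiffOn_id (f := X) (g := g)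
    isOpen_univ hk ?_ hX.locallyIntegrable hg.contDiffOn
  · rw [contDiffOn_univ] at key
    convert key using 1
    ext1 x
    simp only [embedVec, convolution_def, g]
    congr 1
    ext1 y
    rw [map_smul, ContinuousLinearMap.flip_apply, mvL_apply, neg_sub, sub_sub_cancel]
    rfl
  · intro p w _ hw
    have : φ (ε⁻¹ • (-w)) = 0 := by
      apply image_eq_zero_of_notMem_tsupport
      intro h
      exact hw ⟨_, h, by simp [smul_inv_smul₀ hε.ne']⟩
    simp only [g, this, mul_zero, zero_smul]

lemma parts {n : ℕ} (f : Rn n → ℝ) (hf : ContDiff ℝ (⊤ : ℕ∞) f)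
    (Z : Rn n → Rn n) (hZ : ContDiff ℝ (⊤ : ℕ∞) Z)
    (μ : Rn n → ℝ) (hμ : ContDiff ℝ (⊤ : ℕ∞) μ) (hμc : HasCompactSupport μ) :
    ∫ x, lieScal Z f x * μ x = - ∫ x, f x * lieScalDens Z μ x := by
  have hZc : ∀ c, ContDiff ℝ (⊤ : ℕ∞) (fun y => Z y c) := fun c => contDiff_pi.1 hZ c
  have hpd : ∀ (g : Rn n → ℝ), ContDiff ℝ (⊤ : ℕ∞) g → ∀ v, Continuous (fun x => fderiv ℝ g x v) :=
    fun g hg v => (hg.continuous_fderiv (by simp)).clm_apply continuous_const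
  have hG : ∀ c, ContDiff ℝ (⊤ : ℕ∞) (fun y => Z y c * μ y) := fun c => (hZc c).mul hμ
  have hGc : ∀ c, HasCompactSupport (fun y => Z y c * μ y) := fun c => hμc.mul_left
  have hd : ∀ c, Continuous (fun x => fderiv ℝ (fun y => Z y c * μ y) x (Pi.single c 1)) :=
    fun c => hpd _ (hG c) _
  have hdc : ∀ c, HasCompactSupport
      (fun x => fderiv ℝ (fun y => Z y c * μ y) x (Pi.single c 1)) :=
    fun c => (hGc c).fderiv_apply (𝕜 := ℝ) _
  have i1 : ∀ c, Integrable (fun x => fderiv ℝ f x (Pi.single c 1) * (Z x c * μ x)) :=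
    fun c => ((hpd f hf _).mul (hG c).continuous).integrable_of_hasCompactSupport
      (hGc c).mul_left
  have i2 : ∀ c, Integrable
      (fun x => f x * fderiv ℝ (fun y => Z y c * μ y) x (Pi.single c 1)) :=
    fun c => (hf.continuous.mul (hd c)).integrable_of_hasCompactSupport (hdc c).mul_left
  have i3 : ∀ c, Integrable (fun x => f x * (Z x c * μ x)) :=
    fun c => (hf.continuous.mul (hG c).continuous).integrable_of_hasCompactSupport
      (hGc c).mul_left
  have e1 : ∀ x, lieScal Z f x * μ x
      = ∑ c, fderiv ℝ f x (Pi.single c 1) * (Z x c * μ x) := by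
    intro x
    simp only [lieScal, pd, Finset.sum_mul]
    exact Finset.sum_congr rfl fun c _ => by ring
  have e2 : ∀ x, f x * lieScalDens Z μ x
      = ∑ c, f x * fderiv ℝ (fun y => Z y c * μ y) x (Pi.single c 1) := by
    intro x
    simp only [lieScalDens, pd, Finset.sum_mul, ← Finset.sum_add_distrib, Finset.mul_sum]
    refine Finset.sum_congr rfl fun c _ => ?_
    rw [fderiv_fun_mul ((hZc c).differentiable (by simp) x) (hμ.differentiable (by simp) x)]
    simp
    left
    ring
  simp only [e1, e2]
  rw [integral_finsetSum _ fun c _ => i1 c, integral_finsetSum _ fun c _ => i2 c,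
    ← Finset.sum_neg_distrib]
  refine Finset.sum_congr rfl fun c _ => ?_
  rw [integral_mul_fderiv_eq_neg_fderiv_mul_of_integrable (i1 c) (i2 c) (i3 c)
    (fun x _ => hf.differentiable (by simp) x) (fun x _ => (hG c).differentiable (by simp) x),
    neg_neg]

lemma lieScalDens_cont {n : ℕ}
    (Z : Rn n → Rn n) (hZ : ContDiff ℝ (⊤ : ℕ∞) Z)
    (μ : Rn n → ℝ) (hμ : ContDiff ℝ (⊤ : ℕ∞) μ) : Continuous (lieScalDens Z μ) := by
  have hZc : ∀ c, ContDiff ℝ (⊤ : ℕ∞) (fun y => Z y c) := fun c => contDiff_pi.1 hZ c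
  have hpd : ∀ (g : Rn n → ℝ), ContDiff ℝ (⊤ : ℕ∞) g → ∀ v, Continuous (fun x => fderiv ℝ g x v) :=
    fun g hg v => (hg.continuous_fderiv (by simp)).clm_apply continuous_const
  unfold lieScalDens pd
  exact (continuous_finsetSum _ fun c _ => (hZc c).continuous.mul (hpd _ hμ _)).add
    ((continuous_finsetSum _ fun c _ => hpd _ (hZc c) _).mul hμ.continuous)

lemma lieScalDens_zero {n : ℕ} (Z : Rn n → Rn n) (μ : Rn n → ℝ) (x : Rn n)
    (hx : x ∉ tsupport μ) : lieScalDens Z μ x = 0 := by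
  have h1 : μ x = 0 := image_eq_zero_of_notMem_tsupport hx
  have h2 : fderiv ℝ μ x = 0 := by
    by_contra h
    exact hx (support_fderiv_subset ℝ h)
  simp [lieScalDens, pd, h1, h2]

lemma exists_R {n : ℕ} (φ : Rn n → ℝ) (hφc : HasCompactSupport φ) :
    ∃ R > (0:ℝ), ∀ z, φ z ≠ 0 → ‖z‖ ≤ R := by
  obtain ⟨R, hR, h⟩ := (IsCompact.isBounded hφc).exists_pos_norm_le
  exact ⟨R, hR, fun z hz => h z (subset_tsupport _ hz)⟩

lemma bound_integrand {n : ℕ} (φ : Rn n → ℝ) (hφc : HasCompactSupport φ)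
    (Υ : ℝ → Rn n → Rn n → Matrix (Fin n) (Fin n) ℝ)
    (hΥbd : ∀ K : Set (Rn n), IsCompact K → ∀ k : ℕ,
      ∃ δ > (0:ℝ), ∃ C > (0:ℝ), ∃ ε₀ > (0:ℝ), ∀ ε : ℝ, 0 < ε → ε < ε₀ →
        ∀ x ∈ K, ∀ y : Rn n, ‖y - x‖ < δ →
          ‖iteratedFDeriv ℝ k (fun p : Rn n × Rn n => Υ ε p.1 p.2) (x, y)‖ ≤ C)
    (X : Rn n → Rn n) (hX : Continuous X) (K : Set (Rn n)) (hK : IsCompact K) :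
    ∃ B, 0 ≤ B ∧ ∀ᶠ ε in 𝓝[>] (0:ℝ), ∀ x ∈ K, ∀ z,
      ‖φ z • (Υ ε x (x + ε • z)).mulVec (X (x + ε • z))‖ ≤ ‖φ z‖ * B := by
  obtain ⟨R, hR, hRφ⟩ := exists_R φ hφc
  obtain ⟨δ, hδ, C, hC, ε₀, hε₀, hb⟩ := hΥbd K hK 0
  have hK' : IsCompact ((fun p : Rn n × Rn n => p.1 + p.2) '' (K ×ˢ Metric.closedBall (0 : Rn n) R)) :=
    (hK.prod (isCompact_closedBall _ _)).image continuous_add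
  obtain ⟨M, hM0, hM⟩ := (hK'.image hX).isBounded.exists_pos_norm_le
  refine ⟨‖mvL n‖ * C * M, by positivity, ?_⟩
  have hpos : 0 < min (min ε₀ 1) (δ / R) := by positivity
  filter_upwards [Ioo_mem_nhdsGT hpos] with ε hε x hx z
  obtain ⟨h0, h1⟩ := hε
  simp only [lt_min_iff] at h1
  obtain ⟨⟨h1, h2⟩, h3⟩ := h1
  rw [norm_smul]
  by_cases hz : φ z = 0
  · simp [hz]
  have hzR := hRφ z hz
  have hn : ‖ε • z‖ ≤ ε * R := by
    rw [norm_smul, Real.norm_of_nonneg h0.le]; gcongr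
  have hΥ : ‖Υ ε x (x + ε • z)‖ ≤ C := by
    have := hb ε h0 h1 x hx (x + ε • z) (by
      rw [add_sub_cancel_left]
      exact hn.trans_lt ((lt_div_iff₀ hR).1 h3))
    rwa [norm_iteratedFDeriv_zero] at this
  have hXb : ‖X (x + ε • z)‖ ≤ M := by
    apply hM
    refine ⟨_, ⟨(x, ε • z), ⟨hx, ?_⟩, rfl⟩, rfl⟩
    show ε • z ∈ _
    rw [mem_closedBall_zero_iff]
    nlinarith
  gcongr
  refine (mulVec_norm_le _ _).trans ?_
  gcongr

lemma Upsilon_tendsto {n : ℕ} 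
    (Υ : ℝ → Rn n → Rn n → Matrix (Fin n) (Fin n) ℝ)
    (hΥsm : ∀ ε : ℝ, 0 < ε → ContDiff ℝ (⊤ : ℕ∞) (fun p : Rn n × Rn n => Υ ε p.1 p.2))
    (hΥid : ∀ ε : ℝ, 0 < ε → ∀ x, Υ ε x x = 1)
    (hΥbd : ∀ K : Set (Rn n), IsCompact K → ∀ k : ℕ,
      ∃ δ > (0:ℝ), ∃ C > (0:ℝ), ∃ ε₀ > (0:ℝ), ∀ ε : ℝ, 0 < ε → ε < ε₀ →
        ∀ x ∈ K, ∀ y : Rn n, ‖y - x‖ < δ →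
          ‖iteratedFDeriv ℝ k (fun p : Rn n × Rn n => Υ ε p.1 p.2) (x, y)‖ ≤ C)
    (x z : Rn n) :
    Tendsto (fun ε : ℝ => ‖Υ ε x (x + ε • z) - 1‖) (𝓝[>] 0) (𝓝 0) := by
  obtain ⟨δ, hδ, C, hC, ε₀, hε₀, hb⟩ := hΥbd {x} isCompact_singleton 1
  have hlim : Tendsto (fun ε : ℝ => ε • z) (𝓝[>] 0) (𝓝 0) := by
    have : Tendsto (fun ε : ℝ => ε • z) (𝓝 0) (𝓝 ((0:ℝ) • z)) :=
      (continuous_id.smul continuous_const).tendsto _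
    rw [zero_smul] at this
    exact this.mono_left nhdsWithin_le_nhds
  have hsmall : ∀ᶠ ε in 𝓝[>] (0:ℝ), ‖ε • z‖ < δ := by
    have := hlim.norm
    rw [norm_zero] at this
    exact this.eventually_lt_const hδ
  have hlim2 : Tendsto (fun ε : ℝ => C * ‖ε • z‖) (𝓝[>] 0) (𝓝 0) := by
    simpa using hlim.norm.const_mul C
  refine squeeze_zero' (Eventually.of_forall fun _ => norm_nonneg _) ?_ hlim2
  filter_upwards [hsmall, Ioo_mem_nhdsGT hε₀] with ε h1 h2
  have hmv := Convex.norm_image_sub_le_of_norm_fderiv_le (𝕜 := ℝ)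
    (f := fun p : Rn n × Rn n => Υ ε p.1 p.2) (s := {x} ×ˢ Metric.ball x δ) (C := C)
    (x := (x, x)) (y := (x, x + ε • z))
    (fun p _ => (hΥsm ε h2.1).differentiable (by simp) p) ?_
    ((convex_singleton x).prod (convex_ball x δ))
    ⟨rfl, Metric.mem_ball_self hδ⟩ ⟨rfl, by simpa using h1⟩
  · simp only [hΥid ε h2.1, Prod.mk_sub_mk, sub_self, add_sub_cancel_left] at hmv
    rwa [Prod.norm_mk, norm_zero, max_eq_right (norm_nonneg _)] at hmv
  · rintro ⟨p, q⟩ ⟨hp, hq⟩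
    have hp' : p = x := hp
    subst hp'
    rw [← norm_iteratedFDeriv_one]
    exact hb ε h2.1 h2.2 p rfl q (by simpa [dist_eq_norm] using hq)

lemma embedVec_tendsto {n : ℕ}
    (φ : Rn n → ℝ) (hφsm : ContDiff ℝ (⊤ : ℕ∞) φ) (hφc : HasCompactSupport φ)
    (hφ1 : ∫ y : Rn n, φ y = 1)
    (Υ : ℝ → Rn n → Rn n → Matrix (Fin n) (Fin n) ℝ)
    (hΥsm : ∀ ε : ℝ, 0 < ε → ContDiff ℝ (⊤ : ℕ∞) (fun p : Rn n × Rn n => Υ ε p.1 p.2))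
    (hΥid : ∀ ε : ℝ, 0 < ε → ∀ x, Υ ε x x = 1)
    (hΥbd : ∀ K : Set (Rn n), IsCompact K → ∀ k : ℕ,
      ∃ δ > (0:ℝ), ∃ C > (0:ℝ), ∃ ε₀ > (0:ℝ), ∀ ε : ℝ, 0 < ε → ε < ε₀ →
        ∀ x ∈ K, ∀ y : Rn n, ‖y - x‖ < δ →
          ‖iteratedFDeriv ℝ k (fun p : Rn n × Rn n => Υ ε p.1 p.2) (x, y)‖ ≤ C)
    (X : Rn n → Rn n) (hX : Continuous X) (x : Rn n) :
    Tendsto (fun ε => embedVec φ Υ X ε x) (𝓝[>] 0) (𝓝 (X x)) := by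
  obtain ⟨B, hB0, hB⟩ := bound_integrand φ hφc Υ hΥbd X hX {x} isCompact_singleton
  have hφi : Integrable φ := hφsm.continuous.integrable_of_hasCompactSupport hφc
  have hXx : X x = ∫ z, φ z • X x := by rw [integral_smul_const, hφ1, one_smul]
  rw [hXx]
  have key : Tendsto (fun ε : ℝ => ∫ z : Rn n,
      φ z • (Υ ε x (x + ε • z)).mulVec (X (x + ε • z))) (𝓝[>] 0) (𝓝 (∫ z, φ z • X x)) := by
    refine tendsto_integral_filter_of_dominated_convergence (fun z => ‖φ z‖ * B) ?_ ?_
      (hφi.norm.mul_const B) ?_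
    · filter_upwards [self_mem_nhdsWithin] with ε hε
      apply Continuous.aestronglyMeasurable
      have h1 : Continuous (fun z : Rn n => Υ ε x (x + ε • z)) :=
        (hΥsm ε hε).continuous.comp (f := fun z : Rn n => (x, x + ε • z)) (by fun_prop)
      have h2 : Continuous (fun z : Rn n => X (x + ε • z)) := hX.comp (by fun_prop)
      exact hφsm.continuous.smul (h1.matrix_mulVec h2)
    · filter_upwards [hB] with ε hε
      exact Eventually.of_forall fun z => hε x rfl z
    · refine Eventually.of_forall fun z => ?_
      have h1 : Tendsto (fun (ε : ℝ) (i j : Fin n) => Υ ε x (x + ε • z) i j) (𝓝[>] 0)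
          (𝓝 (fun i j : Fin n => (1 : Matrix (Fin n) (Fin n) ℝ) i j)) :=
        tendsto_iff_norm_sub_tendsto_zero.2 (Upsilon_tendsto Υ hΥsm hΥid hΥbd x z)
      have h2 : Tendsto (fun ε : ℝ => X (x + ε • z)) (𝓝[>] 0) (𝓝 (X x)) := by
        have : Continuous (fun ε : ℝ => X (x + ε • z)) := hX.comp (by fun_prop)
        have := this.tendsto 0
        simp only [zero_smul, add_zero] at this
        exact this.mono_left nhdsWithin_le_nhds
      have h3 : Tendsto (fun ε : ℝ => mvL n (fun i j => Υ ε x (x + ε • z) i j) (X (x + ε • z))) (𝓝[>] 0)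
          (𝓝 (mvL n (fun i j => (1 : Matrix (Fin n) (Fin n) ℝ) i j) (X x))) :=
        mvL_tendsto h1 h2
      have h4 : mvL n (fun i j => (1 : Matrix (Fin n) (Fin n) ℝ) i j) (X x) = X x :=
        Matrix.one_mulVec (X x)
      rw [h4] at h3
      exact h3.const_smul (φ z)
  refine key.congr' ?_
  filter_upwards [self_mem_nhdsWithin] with ε hε
  exact (embedVec_subst φ Υ X ε hε x).symm

theorem lie_derivative_of_embedded_contraction_associated {n : ℕ}
    (φ : Rn n → ℝ) (hφsm : ContDiff ℝ (⊤ : ℕ∞) φ) (hφc : HasCompactSupport φ)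
    (hφ1 : ∫ y : Rn n, φ y = 1)
    (Υ : ℝ → Rn n → Rn n → Matrix (Fin n) (Fin n) ℝ)
    (hΥsm : ∀ ε : ℝ, 0 < ε → ContDiff ℝ (⊤ : ℕ∞) (fun p : Rn n × Rn n => Υ ε p.1 p.2))
    (hΥid : ∀ ε : ℝ, 0 < ε → ∀ x, Υ ε x x = 1)
    (hΥbd : ∀ K : Set (Rn n), IsCompact K → ∀ k : ℕ,
      ∃ δ > (0:ℝ), ∃ C > (0:ℝ), ∃ ε₀ > (0:ℝ), ∀ ε : ℝ, 0 < ε → ε < ε₀ →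
        ∀ x ∈ K, ∀ y : Rn n, ‖y - x‖ < δ →
          ‖iteratedFDeriv ℝ k (fun p : Rn n × Rn n => Υ ε p.1 p.2) (x, y)‖ ≤ C)
    (X : Rn n → Rn n) (hX : Continuous X)
    (θ : Rn n → Rn n) (hθ : ContDiff ℝ (⊤ : ℕ∞) θ)
    (Z : Rn n → Rn n) (hZ : ContDiff ℝ (⊤ : ℕ∞) Z)
    (μ : Rn n → ℝ) (hμ : ContDiff ℝ (⊤ : ℕ∞) μ) (hμc : HasCompactSupport μ) :
    Tendsto
      (fun ε => ∫ x : Rn n,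
        lieScal Z (fun x' => ∑ a, embedVec φ Υ X ε x' a * θ x' a) x * μ x)
      (nhdsWithin 0 (Ioi 0))
      (nhds (- ∫ x : Rn n, (∑ a, X x a * θ x a) * lieScalDens Z μ x)) := by
  have hθc : ∀ a, ContDiff ℝ (⊤ : ℕ∞) (fun y => θ y a) := fun a => contDiff_pi.1 hθ a
  have hι : ∀ ε : ℝ, 0 < ε → ∀ a, ContDiff ℝ (⊤ : ℕ∞) (fun y => embedVec φ Υ X ε y a) :=
    fun ε hε a => contDiff_pi.1 (embedVec_contDiff φ hφsm hφc Υ hΥsm X hX ε hε) a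
  have hf : ∀ ε : ℝ, 0 < ε →
      ContDiff ℝ (⊤ : ℕ∞) (fun x' => ∑ a, embedVec φ Υ X ε x' a * θ x' a) :=
    fun ε hε => ContDiff.sum fun a _ => (hι ε hε a).mul (hθc a)
  have hLc := lieScalDens_cont Z hZ μ hμ
  have hL0 := lieScalDens_zero Z μ
  obtain ⟨B, hB0, hB⟩ := bound_integrand φ hφc Υ hΥbd X hX (tsupport μ) hμc
  have hφi : Integrable φ := hφsm.continuous.integrable_of_hasCompactSupport hφc
  have key : Tendsto (fun ε => ∫ x : Rn n,
      (∑ a, embedVec φ Υ X ε x a * θ x a) * lieScalDens Z μ x) (𝓝[>] 0)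
      (𝓝 (∫ x : Rn n, (∑ a, X x a * θ x a) * lieScalDens Z μ x)) := by
    refine tendsto_integral_filter_of_dominated_convergence
      (fun x => (∑ a, (∫ z, ‖φ z‖ * B) * ‖θ x a‖) * ‖lieScalDens Z μ x‖) ?_ ?_ ?_ ?_
    · filter_upwards [self_mem_nhdsWithin] with ε hε
      exact ((hf ε hε).continuous.mul hLc).aestronglyMeasurable
    · filter_upwards [hB, self_mem_nhdsWithin] with ε hε h0
      refine Eventually.of_forall fun x => ?_
      rw [norm_mul]
      by_cases hx : x ∈ tsupport μ
      · have hE : ‖embedVec φ Υ X ε x‖ ≤ ∫ z, ‖φ z‖ * B := by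
          rw [embedVec_subst φ Υ X ε h0 x]
          exact norm_integral_le_of_norm_le (hφi.norm.mul_const B)
            (Eventually.of_forall fun z => hε x hx z)
        gcongr
        refine (norm_sum_le _ _).trans (Finset.sum_le_sum fun a _ => ?_)
        rw [norm_mul]
        gcongr
        exact (norm_le_pi_norm _ a).trans hE
      · simp [hL0 x hx]
    · apply Continuous.integrable_of_hasCompactSupport
      · exact (continuous_finsetSum _ fun a _ =>
          continuous_const.mul (hθc a).continuous.norm).mul hLc.norm
      · refine HasCompactSupport.intro hμc fun x hx => ?_
        simp [hL0 x hx]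
    · refine Eventually.of_forall fun x => ?_
      have h := embedVec_tendsto φ hφsm hφc hφ1 Υ hΥsm hΥid hΥbd X hX x
      rw [tendsto_pi_nhds] at h
      exact (tendsto_finsetSum _ fun a _ => (h a).mul_const _).mul_const _
  refine key.neg.congr' ?_
  filter_upwards [self_mem_nhdsWithin] with ε hε
  exact (parts _ (hf ε hε) Z hZ μ hμ hμc).symm
end

section
/- Delta-net convergence of the tensor embedding: let T be a distributional (r,s) tensor field on ℝⁿ, (ω_ε) a delta net of smoothing kernels and (Υ_ε) an admissible net of transport operators. Then the smooth tensor fields ι(T)(Υ_ε, ω_ε) converge to T in D'ʳ_s(ℝⁿ): for every compactly supported smooth (s,r) tensor density Ψ, lim_{ε→0} ∫ ι(T)(Υ_ε,ω_ε)(x)·Ψ(x) dx = ⟨T, Ψ⟩. Consequently the distributional limit of the embedding is independent of the choice of admissible transport operators and delta nets. -/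
/- STATEMENT 16: Delta-net convergence of the tensor embedding.  Local model on ℝⁿ,
with the distributional (r,s) tensor field T of locally finite order written (by the
structure theorem, as the context allows) as T = ∂^α f with f a continuous tensor field
and ∂^α an iterated partial derivative (here a list L of coordinate directions), so that
⟨T,Ψ⟩ = (−1)^{|L|} ∫ f · ∂^L Ψ.  The embedding ι(T)(Υ_ε,ω_ε)(x) pairs T with the test
density Ψ_x built from the transported covectors/vectors and the kernel
ω_{x,ε}(y) = ε^{−n}φ((y−x)/ε).  Claim: for every compactly supported smooth (s,r)
tensor density Ψ, ∫ ι(T)(Υ_ε,ω_ε)(x)·Ψ(x) dx → ⟨T,Ψ⟩ as ε → 0⁺, i.e. ι(T)(Υ_ε,ω_ε) → T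
in D'ʳ_s; consequently the distributional limit of the embedding is independent of the
choice of admissible transport operators and delta nets. -/

open MeasureTheory Filter Set Topology

attribute [local instance] Matrix.normedAddCommGroup Matrix.normedSpace

abbrev Tens (n r s : ℕ) := (Fin r → Fin n) → (Fin s → Fin n) → ℝ

/-- Iterated partial derivative along the list of directions L. -/
noncomputable def pds {n : ℕ} (L : List (Fin n)) (f : Rn n → ℝ) : Rn n → ℝ :=
  L.foldr pd f

/-- The embedding of the distributional tensor field T = ∂^L f (f continuous):
component (i,j) at x is ⟨T, Ψ_x^{i,j}⟩ where Ψ_x^{i,j} is the tensor density built from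
the transported basis covectors/vectors and the kernel. -/
noncomputable def embedDistTens {n r s : ℕ} (φ : Rn n → ℝ)
    (Υ : ℝ → Rn n → Rn n → Matrix (Fin n) (Fin n) ℝ)
    (L : List (Fin n)) (f : Rn n → Tens n r s) (ε : ℝ) (x : Rn n) : Tens n r s :=
  fun i j => (-1 : ℝ) ^ L.length *
    ∑ p : Fin r → Fin n, ∑ q : Fin s → Fin n,
      ∫ y : Rn n, f y p q *
        pds L (fun y' => (∏ k : Fin r, Υ ε x y' (i k) (p k)) *
          (∏ k : Fin s, Υ ε y' x (q k) (j k)) *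
          ((ε ^ n)⁻¹ * φ (ε⁻¹ • (y' - x)))) y

section DeltaNetHelpers

variable {V W : Type*} [NormedAddCommGroup V] [NormedSpace ℝ V]
  [NormedAddCommGroup W] [NormedSpace ℝ W]

/-- Directional derivative. -/
noncomputable def dd (v : V) (g : V → ℝ) : V → ℝ := fun x => fderiv ℝ g x v

/-- Iterated directional derivative. -/
noncomputable def dds (vs : List V) (g : V → ℝ) : V → ℝ := vs.foldr dd g

theorem dds_cons (v : V) (vs : List V) (g : V → ℝ) : dds (v :: vs) g = dd v (dds vs g) := rfl

theorem dds_nil (g : V → ℝ) : dds ([] : List V) g = g := rfl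

theorem contDiff_dd {g : V → ℝ} (hg : ContDiff ℝ (⊤ : ℕ∞) g) (v : V) :
    ContDiff ℝ (⊤ : ℕ∞) (dd v g) := by
  have h : ContDiff ℝ (⊤ : ℕ∞) (fderiv ℝ g) := hg.fderiv_right (by simp)
  exact h.clm_apply contDiff_const

theorem contDiff_dds {g : V → ℝ} (hg : ContDiff ℝ (⊤ : ℕ∞) g) (vs : List V) :
    ContDiff ℝ (⊤ : ℕ∞) (dds vs g) := by
  induction vs with
  | nil => exact hg
  | cons v vs ih => exact contDiff_dd ih v

theorem smooth_diff {g : V → ℝ} (hg : ContDiff ℝ (⊤ : ℕ∞) g) : Differentiable ℝ g :=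
  hg.differentiable (by simp)

theorem dd_comm {g : V → ℝ} (hg : ContDiff ℝ (⊤ : ℕ∞) g) (v w : V) :
    dd v (dd w g) = dd w (dd v g) := by
  have h : ContDiff ℝ (⊤ : ℕ∞) (fderiv ℝ g) := hg.fderiv_right (by simp)
  have hd : Differentiable ℝ (fderiv ℝ g) := h.differentiable (by simp)
  have key : ∀ (v w : V) x, dd v (dd w g) x = fderiv ℝ (fderiv ℝ g) x v w := by
    intro v w x
    unfold dd
    rw [fderiv_clm_apply (hd x) (differentiableAt_const w)]
    simp
  funext x
  rw [key, key]
  have hs : IsSymmSndFDerivAt ℝ g x := hg.contDiffAt.isSymmSndFDerivAt (by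
    simp only [minSmoothness_of_isRCLikeNormedField]
    exact WithTop.coe_le_coe.2 (le_top : (2:ℕ∞) ≤ ⊤))
  exact hs v w

theorem dd_dds_comm {g : V → ℝ} (hg : ContDiff ℝ (⊤ : ℕ∞) g) (v : V) (vs : List V) :
    dd v (dds vs g) = dds vs (dd v g) := by
  induction vs with
  | nil => rfl
  | cons w vs ih => rw [dds_cons, dds_cons, dd_comm (contDiff_dds hg vs), ih]

theorem dds_mul_const {h k : V → ℝ} (hh : ContDiff ℝ (⊤ : ℕ∞) h) (hk : ContDiff ℝ (⊤ : ℕ∞) k)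
    (vs : List V) (hz : ∀ v ∈ vs, ∀ x, dd v k x = 0) :
    dds vs (fun x => h x * k x) = fun x => dds vs h x * k x := by
  induction vs with
  | nil => rfl
  | cons v vs ih =>
    rw [dds_cons, ih (fun w hw => hz w (List.mem_cons_of_mem _ hw))]
    funext x
    have h1 := smooth_diff (contDiff_dds hh vs) x
    have h2 := smooth_diff hk x
    have h3 := hz v (List.mem_cons_self) x
    unfold dd at h3
    rw [dds_cons]
    unfold dd
    rw [fderiv_fun_mul h1 h2]
    simp [h3, mul_comm]

theorem dds_comp_affine {g : V → ℝ} (hg : ContDiff ℝ (⊤ : ℕ∞) g) (B : W →L[ℝ] V) (a : V)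
    (ws : List W) :
    dds ws (fun w => g (a + B w)) = fun w => dds (ws.map B) g (a + B w) := by
  induction ws with
  | nil => rfl
  | cons w ws ih =>
    rw [dds_cons, ih, List.map_cons, dds_cons]
    funext x
    unfold dd
    have h1 := (smooth_diff (contDiff_dds hg (ws.map B)) (a + B x)).hasFDerivAt
    have h2 : HasFDerivAt (fun w => a + B w) B x := B.hasFDerivAt.const_add a
    have h3 := h1.comp x h2
    have h4 : fderiv ℝ (fun w => dds (ws.map B) g (a + B w)) x = _ := h3.fderiv
    rw [h4]
    rfl

theorem tsupport_dds (g : V → ℝ) (vs : List V) : tsupport (dds vs g) ⊆ tsupport g := by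
  induction vs with
  | nil => exact subset_rfl
  | cons v vs ih =>
    refine subset_trans ?_ ih
    exact tsupport_fderiv_apply_subset ℝ v

theorem hasCompactSupport_dds {g : V → ℝ} (hg : HasCompactSupport g) (vs : List V) :
    HasCompactSupport (dds vs g) :=
  hg.of_isClosed_subset (isClosed_tsupport _) (tsupport_dds g vs)

theorem pds_eq_dds {n : ℕ} (L : List (Fin n)) (f : Rn n → ℝ) :
    pds L f = dds (L.map (fun c => (Pi.single c 1 : Rn n))) f := by
  induction L with
  | nil => rfl
  | cons c L ih =>
    rw [List.map_cons, dds_cons, ← ih]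
    rfl

theorem integral_dd_zero {n : ℕ} {g : Rn n → ℝ} (hg : ContDiff ℝ (⊤ : ℕ∞) g)
    (hc : HasCompactSupport g) (v : Rn n) : ∫ x, dd v g x = 0 := by
  have h1 : Integrable (dd v g) :=
    (contDiff_dd hg v).continuous.integrable_of_hasCompactSupport (hasCompactSupport_dds hc [v])
  have h2 : Integrable g := hg.continuous.integrable_of_hasCompactSupport hc
  unfold dd at h1 ⊢
  have := integral_mul_fderiv_eq_neg_fderiv_mul_of_integrable (μ := (volume : Measure (Rn n)))
    (f := fun _ : Rn n => (1:ℝ)) (g := g) (v := v) (by simp) (by simpa [dd] using h1)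
    (by simpa using h2) (fun x _ => differentiableAt_const _) (fun x _ => smooth_diff hg x)
  simpa [dd] using this

theorem hasCompactSupport_slice {n : ℕ} {H : Rn n × Rn n → ℝ} (hc : HasCompactSupport H)
    (y : Rn n) : HasCompactSupport (fun x => H (x, y)) := by
  apply HasCompactSupport.intro (hc.isCompact.image continuous_fst)
  intro x hx
  by_contra hne
  exact hx ⟨(x, y), subset_tsupport _ hne, rfl⟩

theorem integral_dds_diag {n : ℕ} (y : Rn n) (L : List (Rn n)) :
    ∀ {H : Rn n × Rn n → ℝ}, ContDiff ℝ (⊤ : ℕ∞) H → HasCompactSupport H →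
    ∫ x, dds (L.map (fun e => ((0 : Rn n), e))) H (x, y) =
      ∫ x, dds (L.map (fun e => (e, e))) H (x, y) := by
  induction L with
  | nil => intro H _ _; rfl
  | cons e L ih =>
    intro H hH hc
    rw [List.map_cons, List.map_cons, dds_cons, dds_cons, dd_dds_comm hH, dd_dds_comm hH]
    have hint : ∀ v : Rn n × Rn n, Integrable (fun x =>
        dds (L.map (fun e => ((0 : Rn n), e))) (dd v H) (x, y)) := fun v =>
      ((contDiff_dds (contDiff_dd hH v) _).continuous.comp
        (by fun_prop : Continuous fun x : Rn n => (x, y))).integrable_of_hasCompactSupport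
        (hasCompactSupport_slice (hasCompactSupport_dds (hasCompactSupport_dds hc [v]) _) y)
    have hz : ∫ x, dds (L.map (fun e => ((0 : Rn n), e))) (dd (e, 0) H) (x, y) = 0 := by
      rw [← dd_dds_comm hH]
      set G := dds (L.map (fun e => ((0 : Rn n), e))) H with hG
      have hGs : ContDiff ℝ (⊤ : ℕ∞) G := contDiff_dds hH _
      have hGc : HasCompactSupport G := hasCompactSupport_dds hc _
      have := integral_dd_zero (g := fun x => G (x, y)) (by fun_prop)
        (hasCompactSupport_slice hGc y) e
      rw [← this]
      congr 1
      funext x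
      have h1 := dds_comp_affine hGs (ContinuousLinearMap.inl ℝ (Rn n) (Rn n)) (0, y) [e]
      simp only [ContinuousLinearMap.inl_apply, Prod.mk_add_mk, zero_add, add_zero,
        List.map_cons, List.map_nil] at h1
      exact (congrFun h1 x).symm
    have hdec : ∀ x, dds (L.map (fun e => ((0 : Rn n), e))) (dd (e, e) H) (x, y) =
        dds (L.map (fun e => ((0 : Rn n), e))) (dd (0, e) H) (x, y) +
        dds (L.map (fun e => ((0 : Rn n), e))) (dd (e, 0) H) (x, y) := by
      intro x
      rw [← dd_dds_comm hH, ← dd_dds_comm hH, ← dd_dds_comm hH]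
      unfold dd
      rw [← map_add]
      simp
    rw [← ih (contDiff_dd hH (e, e)) (hasCompactSupport_dds hc [(e, e)])]
    simp_rw [hdec]
    rw [integral_add (hint _) (hint _), hz, add_zero]

/-- Local uniform boundedness (as `ε → 0⁺`) of all derivatives of a net near a point. -/
def LB (g : ℝ → V → ℝ) (v₀ : V) : Prop :=
  ∀ k : ℕ, ∃ C : ℝ, ∀ᶠ q in 𝓝 ((0 : ℝ), v₀), 0 < q.1 →
    ‖iteratedFDeriv ℝ k (g q.1) q.2‖ ≤ C

theorem LB.mul {g h : ℝ → V → ℝ} {v₀ : V} (hg : LB g v₀) (hh : LB h v₀)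
    (sg : ∀ ε, 0 < ε → ContDiff ℝ (⊤ : ℕ∞) (g ε)) (sh : ∀ ε, 0 < ε → ContDiff ℝ (⊤ : ℕ∞) (h ε)) :
    LB (fun ε v => g ε v * h ε v) v₀ := by
  intro k
  choose C hC using hg
  choose D hD using hh
  refine ⟨∑ i ∈ Finset.range (k + 1), (k.choose i : ℝ) * C i * D (k - i), ?_⟩
  have h1 : ∀ᶠ q in 𝓝 ((0 : ℝ), v₀), ∀ i ∈ Finset.range (k + 1), 0 < q.1 →
      ‖iteratedFDeriv ℝ i (g q.1) q.2‖ ≤ C i :=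
    (Filter.eventually_all_finset _).2 fun i _ => hC i
  have h2 : ∀ᶠ q in 𝓝 ((0 : ℝ), v₀), ∀ i ∈ Finset.range (k + 1), 0 < q.1 →
      ‖iteratedFDeriv ℝ (k - i) (h q.1) q.2‖ ≤ D (k - i) :=
    (Filter.eventually_all_finset _).2 fun i _ => hD (k - i)
  filter_upwards [h1, h2] with q hq1 hq2 hpos
  refine (norm_iteratedFDeriv_mul_le (sg _ hpos) (sh _ hpos) q.2
    (n := k) (by exact mod_cast (le_top : (k : ℕ∞) ≤ ⊤))).trans ?_
  refine Finset.sum_le_sum fun i hi => ?_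
  have a1 := hq1 i hi hpos
  have a2 := hq2 i hi hpos
  have : 0 ≤ C i := (norm_nonneg _).trans a1
  gcongr

theorem LB.const {g : V → ℝ} (hg : ContDiff ℝ (⊤ : ℕ∞) g) (v₀ : V) : LB (fun _ => g) v₀ := by
  intro k
  refine ⟨‖iteratedFDeriv ℝ k g v₀‖ + 1, ?_⟩
  have hc : Continuous (fun q : ℝ × V => ‖iteratedFDeriv ℝ k g q.2‖) :=
    ((hg.continuous_iteratedFDeriv (m := k) (by exact mod_cast (le_top : (k : ℕ∞) ≤ ⊤))).comp
      continuous_snd).norm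
  have := hc.continuousAt.eventually_lt (x₀ := ((0 : ℝ), v₀))
    (continuousAt_const (y := ‖iteratedFDeriv ℝ k g v₀‖ + 1)) (by simp)
  filter_upwards [this] with q hq _ using hq.le

theorem LB.prod {ι : Type*} (S : Finset ι) {g : ι → ℝ → V → ℝ} {v₀ : V}
    (hg : ∀ i, LB (g i) v₀) (sg : ∀ i, ∀ ε, 0 < ε → ContDiff ℝ (⊤ : ℕ∞) (g i ε)) :
    LB (fun ε v => ∏ i ∈ S, g i ε v) v₀ := by
  classical
  induction S using Finset.induction_on with
  | empty => simpa using LB.const (contDiff_const (c := (1 : ℝ))) v₀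
  | insert a S ha ih =>
    simp only [Finset.prod_insert ha]
    exact (hg a).mul ih (sg a) (fun ε hε => contDiff_prod fun i _ => sg i ε hε)

theorem LB.dd {g : ℝ → V → ℝ} {v₀ : V} (hg : LB g v₀)
    (sg : ∀ ε, 0 < ε → ContDiff ℝ (⊤ : ℕ∞) (g ε)) (v : V) :
    LB (fun ε => dd v (g ε)) v₀ := by
  intro k
  obtain ⟨C, hC⟩ := hg (k + 1)
  refine ⟨‖ContinuousLinearMap.apply ℝ ℝ v‖ * C, ?_⟩
  filter_upwards [hC] with q hq hpos
  have h : ContDiff ℝ (⊤ : ℕ∞) (fderiv ℝ (g q.1)) := (sg _ hpos).fderiv_right (by simp)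
  have h1 := (ContinuousLinearMap.apply ℝ ℝ v).norm_iteratedFDeriv_comp_left
    (h.contDiffAt (x := q.2)) (n := k) (by exact mod_cast (le_top : (k : ℕ∞) ≤ ⊤))
  rw [norm_iteratedFDeriv_fderiv] at h1
  refine LE.le.trans h1 ?_
  gcongr
  exact hq hpos

theorem LB.dds {g : ℝ → V → ℝ} {v₀ : V} (hg : LB g v₀)
    (sg : ∀ ε, 0 < ε → ContDiff ℝ (⊤ : ℕ∞) (g ε)) (vs : List V) :
    LB (fun ε => dds vs (g ε)) v₀ := by
  induction vs with
  | nil => exact hg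
  | cons v vs ih => exact ih.dd (fun ε hε => contDiff_dds (sg ε hε) vs) v

theorem LB.equicont {g : ℝ → V → ℝ} {v₀ : V} (hg : LB g v₀)
    (sg : ∀ ε, 0 < ε → ContDiff ℝ (⊤ : ℕ∞) (g ε)) {η : ℝ} (hη : 0 < η) :
    ∃ δ > 0, ∀ ε, 0 < ε → ε < δ → ∀ u w, dist u v₀ < δ → dist w v₀ < δ →
      |g ε u - g ε w| ≤ η := by
  obtain ⟨C, hC⟩ := hg 1
  obtain ⟨δ, hδ, hb⟩ := Metric.eventually_nhds_iff.1 hC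
  have hC1 : 0 < |C| + 1 := by positivity
  refine ⟨min δ (η / (2 * (|C| + 1))), by positivity, ?_⟩
  intro ε hε hεδ u w hu hw
  have hball : Convex ℝ (Metric.ball v₀ (min δ (η / (2 * (|C| + 1))))) := convex_ball _ _
  have key := hball.norm_image_sub_le_of_norm_fderiv_le (𝕜 := ℝ) (f := g ε) (C := |C| + 1)
    (fun x _ => smooth_diff (sg ε hε) x) (fun x hx => by
      have := hb (y := (ε, x)) (by
        rw [Prod.dist_eq]
        apply max_lt
        · simp only [Real.dist_eq, sub_zero, abs_of_pos hε]
          exact hεδ.trans_le (min_le_left _ _)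
        · exact (Metric.mem_ball.1 hx).trans_le (min_le_left _ _)) hε
      rw [norm_iteratedFDeriv_one] at this
      exact this.trans ((le_abs_self C).trans (by linarith))) hw hu
  rw [← Real.norm_eq_abs]
  refine key.trans ?_
  have hd : ‖u - w‖ ≤ 2 * (η / (2 * (|C| + 1))) := by
    rw [← dist_eq_norm]
    have := dist_triangle_right u w v₀
    have a1 := hu.trans_le (min_le_right _ _)
    have a2 := hw.trans_le (min_le_right _ _)
    linarith
  calc (|C| + 1) * ‖u - w‖ ≤ (|C| + 1) * (2 * (η / (2 * (|C| + 1)))) := by gcongr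
    _ = η := by field_simp

/-- The rescaled kernel. -/
theorem kernel_integral {n : ℕ} (φ : Rn n → ℝ) {ε : ℝ} (hε : 0 < ε) (y : Rn n) :
    ∫ x, (ε ^ n)⁻¹ * φ (ε⁻¹ • (y - x)) = ∫ x, φ x := by
  rw [integral_sub_left_eq_self (fun x => (ε ^ n)⁻¹ * φ (ε⁻¹ • x)) volume y,
    integral_const_mul, Measure.integral_comp_smul]
  simp only [Module.finrank_fin_fun, smul_eq_mul, inv_pow, inv_inv]
  rw [abs_of_pos (by positivity), ← mul_assoc, inv_mul_cancel₀ (by positivity), one_mul]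

theorem approx_bound {n : ℕ} {φ : Rn n → ℝ} (hφsm : Continuous φ)
    (hφ1 : ∫ y : Rn n, φ y = 1) {R : ℝ} (hR : ∀ z, φ z ≠ 0 → ‖z‖ ≤ R)
    {ε : ℝ} (hε : 0 < ε) {g : Rn n → ℝ} (hg : Continuous g) (y : Rn n) {η : ℝ}
    (hη : ∀ x, ‖y - x‖ ≤ ε * R → |g x - g y| ≤ η) :
    |(∫ x, g x * ((ε ^ n)⁻¹ * φ (ε⁻¹ • (y - x)))) - g y| ≤ η * ∫ x, |φ x| := by
  have hk : Continuous (fun x => (ε ^ n)⁻¹ * φ (ε⁻¹ • (y - x))) := by fun_prop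
  have hkc : HasCompactSupport (fun x => (ε ^ n)⁻¹ * φ (ε⁻¹ • (y - x))) := by
    apply HasCompactSupport.intro (isCompact_closedBall y (ε * R))
    intro x hx
    by_contra hne
    apply hx
    have := hR _ (right_ne_zero_of_mul hne)
    rw [norm_smul, norm_inv, Real.norm_of_nonneg hε.le, inv_mul_le_iff₀ hε] at this
    rw [Metric.mem_closedBall, dist_comm, dist_eq_norm]
    exact this
  have e1 : g y = ∫ x, g y * ((ε ^ n)⁻¹ * φ (ε⁻¹ • (y - x))) := by
    rw [integral_const_mul, kernel_integral φ hε, hφ1, mul_one]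
  have i1 : Integrable (fun x => g x * ((ε ^ n)⁻¹ * φ (ε⁻¹ • (y - x)))) :=
    (hg.mul hk).integrable_of_hasCompactSupport hkc.mul_left
  have i2 : Integrable (fun x => g y * ((ε ^ n)⁻¹ * φ (ε⁻¹ • (y - x)))) :=
    (continuous_const.mul hk).integrable_of_hasCompactSupport hkc.mul_left
  have i3 : Integrable (fun x => (ε ^ n)⁻¹ * |φ (ε⁻¹ • (y - x))|) := by
    have := (hk.integrable_of_hasCompactSupport (μ := volume) hkc).abs
    simpa [abs_mul, abs_of_pos hε] using this
  rw [← kernel_integral (fun x => |φ x|) hε y, ← integral_const_mul]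
  have e2 : (∫ x, g x * ((ε ^ n)⁻¹ * φ (ε⁻¹ • (y - x)))) - g y =
      ∫ x, (g x * ((ε ^ n)⁻¹ * φ (ε⁻¹ • (y - x))) -
        g y * ((ε ^ n)⁻¹ * φ (ε⁻¹ • (y - x)))) := by
    rw [integral_sub i1 i2, ← e1]
  rw [e2, ← Real.norm_eq_abs]
  refine norm_integral_le_of_norm_le (i3.const_mul η) (Eventually.of_forall fun x => ?_)
  rw [← sub_mul, norm_mul, norm_mul, Real.norm_of_nonneg (by positivity : 0 ≤ (ε ^ n)⁻¹),
    Real.norm_eq_abs, Real.norm_eq_abs]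
  by_cases h0 : φ (ε⁻¹ • (y - x)) = 0
  · simp [h0]
  · have := hR _ h0
    rw [norm_smul, norm_inv, Real.norm_of_nonneg hε.le, inv_mul_le_iff₀ hε] at this
    have := hη x this
    gcongr

theorem component_tendsto {n : ℕ}
    (φ : Rn n → ℝ) (hφsm : ContDiff ℝ (⊤ : ℕ∞) φ) (hφc : HasCompactSupport φ)
    (hφ1 : ∫ y : Rn n, φ y = 1)
    (a : ℝ → Rn n × Rn n → ℝ) (sa : ∀ ε, 0 < ε → ContDiff ℝ (⊤ : ℕ∞) (a ε))
    (la : ∀ x, LB a (x, x)) (c : ℝ) (ha : ∀ ε, 0 < ε → ∀ x, a ε (x, x) = c)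
    (L : List (Fin n)) (f : Rn n → ℝ) (hf : Continuous f)
    (ψ : Rn n → ℝ) (hψ : ContDiff ℝ (⊤ : ℕ∞) ψ) (hψc : HasCompactSupport ψ) :
    (∀ ε, 0 < ε → Integrable (fun x => (∫ y, f y *
      pds L (fun y' => a ε (x, y') * ((ε ^ n)⁻¹ * φ (ε⁻¹ • (y' - x)))) y) * ψ x)) ∧
    Tendsto (fun ε => ∫ x, (∫ y, f y *
      pds L (fun y' => a ε (x, y') * ((ε ^ n)⁻¹ * φ (ε⁻¹ • (y' - x)))) y) * ψ x)
      (𝓝[>] 0) (𝓝 (c * ∫ y, f y * pds L ψ y)) := by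
  obtain ⟨R, hR1, hR⟩ : ∃ R : ℝ, 0 < R ∧ ∀ z, φ z ≠ 0 → ‖z‖ ≤ R := by
    obtain ⟨R, hR⟩ := hφc.isCompact.isBounded.subset_closedBall 0
    refine ⟨max R 1, by positivity, fun z hz => ?_⟩
    have := hR (subset_tsupport _ hz)
    rw [mem_closedBall_zero_iff] at this
    exact this.trans (le_max_left _ _)
  set es : List (Rn n) := L.map (fun c => (Pi.single c 1 : Rn n)) with hes
  set ρ : ℝ → Rn n × Rn n → ℝ := fun ε p => (ε ^ n)⁻¹ * φ (ε⁻¹ • (p.2 - p.1)) with hρ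
  have sρ : ∀ ε, ContDiff ℝ (⊤ : ℕ∞) (ρ ε) := fun ε => by
    simp only [hρ]; fun_prop
  have sψ : ContDiff ℝ (⊤ : ℕ∞) (fun p : Rn n × Rn n => ψ p.1) := by fun_prop
  set H : ℝ → Rn n × Rn n → ℝ := fun ε p => (a ε p * ρ ε p) * ψ p.1 with hH
  have sA : ∀ ε, 0 < ε → ContDiff ℝ (⊤ : ℕ∞) (fun p => a ε p * ρ ε p) :=
    fun ε hε => (sa ε hε).mul (sρ ε)
  have sH : ∀ ε, 0 < ε → ContDiff ℝ (⊤ : ℕ∞) (H ε) := fun ε hε => (sA ε hε).mul sψ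
  set h : ℝ → Rn n × Rn n → ℝ := fun ε p => a ε p * ψ p.1 with hh
  have sh : ∀ ε, 0 < ε → ContDiff ℝ (⊤ : ℕ∞) (h ε) := fun ε hε => (sa ε hε).mul sψ
  set G : ℝ → Rn n × Rn n → ℝ := fun ε => dds (es.map (fun e => (e, e))) (h ε) with hG
  have sG : ∀ ε, 0 < ε → ContDiff ℝ (⊤ : ℕ∞) (G ε) := fun ε hε => contDiff_dds (sh ε hε) _
  have lG : ∀ x, LB G (x, x) := fun x =>
    ((la x).mul (LB.const sψ _) sa (fun _ _ => sψ)).dds sh _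
  -- supports
  have suppH : ∀ ε, 0 < ε → ∀ p, p ∉ (fun p : Rn n × Rn n => (p.1, p.1 + ε • p.2)) ''
      (tsupport ψ ×ˢ Metric.closedBall 0 R) → H ε p = 0 := by
    intro ε hε p hp
    by_contra hne
    apply hp
    refine ⟨(p.1, ε⁻¹ • (p.2 - p.1)), ⟨subset_tsupport _ (right_ne_zero_of_mul hne), ?_⟩, ?_⟩
    · rw [mem_closedBall_zero_iff]
      exact hR _ (right_ne_zero_of_mul (right_ne_zero_of_mul (left_ne_zero_of_mul hne)))
    · simp [smul_smul, hε.ne']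
  have compC : ∀ ε : ℝ, IsCompact ((fun p : Rn n × Rn n => (p.1, p.1 + ε • p.2)) ''
      (tsupport ψ ×ˢ Metric.closedBall 0 R)) := fun ε =>
    (hψc.isCompact.prod (isCompact_closedBall _ _)).image (by fun_prop)
  have cH : ∀ ε, 0 < ε → HasCompactSupport (H ε) := fun ε hε =>
    HasCompactSupport.intro (compC ε) (suppH ε hε)
  have tH : ∀ ε, 0 < ε → tsupport (H ε) ⊆ (fun p : Rn n × Rn n => (p.1, p.1 + ε • p.2)) ''
      (tsupport ψ ×ˢ Metric.closedBall 0 R) := fun ε hε =>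
    closure_minimal (fun p hp => by
      by_contra hq
      exact hp (suppH ε hε p hq)) (compC ε).isClosed
  -- slices
  have slice : ∀ ε, 0 < ε → ∀ x y, pds L (fun y' => a ε (x, y') *
      ((ε ^ n)⁻¹ * φ (ε⁻¹ • (y' - x)))) y * ψ x =
      dds (es.map (fun e => ((0 : Rn n), e))) (H ε) (x, y) := by
    intro ε hε x y
    have h1 := dds_comp_affine (sA ε hε) (ContinuousLinearMap.inr ℝ (Rn n) (Rn n)) (x, 0) es
    simp only [ContinuousLinearMap.inr_apply, Prod.mk_add_mk, zero_add, add_zero] at h1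
    have h2 := dds_mul_const (sA ε hε) sψ (es.map (fun e => ((0 : Rn n), e))) (by
      intro v hv p
      obtain ⟨e, -, rfl⟩ := List.mem_map.1 hv
      have h3 := dds_comp_affine hψ (ContinuousLinearMap.fst ℝ (Rn n) (Rn n)) 0 [((0 : Rn n), e)]
      simp only [zero_add] at h3
      refine (congrFun h3 p).trans ?_
      simp [dds, dd])
    rw [pds_eq_dds]
    refine Eq.trans ?_ (congrFun h2 (x, y)).symm
    exact congrArg (· * ψ x) (congrFun h1 y)
  have diagH : ∀ ε, 0 < ε → ∀ p, dds (es.map (fun e => (e, e))) (H ε) p = G ε p * ρ ε p := by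
    intro ε hε p
    have h2 := dds_mul_const (sh ε hε) (sρ ε) (es.map (fun e => (e, e))) (by
      intro v hv p
      obtain ⟨e, -, rfl⟩ := List.mem_map.1 hv
      have h3 := dds_comp_affine (g := fun z => (ε ^ n)⁻¹ * φ (ε⁻¹ • z)) (by fun_prop)
        (ContinuousLinearMap.snd ℝ (Rn n) (Rn n) - ContinuousLinearMap.fst ℝ (Rn n) (Rn n)) 0
        [(e, e)]
      simp only [zero_add] at h3
      refine (congrFun h3 p).trans ?_
      simp [dds, dd])
    refine Eq.trans ?_ (congrFun h2 p)
    congr 1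
    funext p
    simp only [hH, hh]
    ring
  have diagG : ∀ ε, 0 < ε → ∀ y, G ε (y, y) = c * pds L ψ y := by
    intro ε hε y
    have h1 := dds_comp_affine (sh ε hε)
      ((ContinuousLinearMap.id ℝ (Rn n)).prod (ContinuousLinearMap.id ℝ (Rn n))) 0 es
    simp only [zero_add] at h1
    have h2 := dds_mul_const hψ (contDiff_const (c := c)) es (by
      intro v _ p
      simp [dd])
    rw [pds_eq_dds, mul_comm]
    refine (congrFun h1 y).symm.trans (Eq.trans ?_ (congrFun h2 y))
    congr 1
    funext w
    simp [hh, ha ε hε w, mul_comm]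
  have intF : ∀ ε, 0 < ε → Integrable (fun p : Rn n × Rn n => f p.2 *
      dds (es.map (fun e => ((0 : Rn n), e))) (H ε) p) (volume.prod volume) := by
    intro ε hε
    have := ((hf.comp continuous_snd).mul (contDiff_dds (sH ε hε)
      (es.map (fun e => ((0 : Rn n), e)))).continuous).integrable_of_hasCompactSupport
      (μ := (volume : Measure (Rn n)).prod volume)
      (hasCompactSupport_dds (cH ε hε) _).mul_left
    exact this
  have inner : ∀ ε, 0 < ε → ∀ x, (∫ y, f y *
      pds L (fun y' => a ε (x, y') * ((ε ^ n)⁻¹ * φ (ε⁻¹ • (y' - x)))) y) * ψ x =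
      ∫ y, f y * dds (es.map (fun e => ((0 : Rn n), e))) (H ε) (x, y) := by
    intro ε hε x
    rw [← integral_mul_const]
    congr 1
    funext y
    rw [mul_assoc, slice ε hε]
  refine ⟨fun ε hε => ?_, ?_⟩
  · simp_rw [inner ε hε]
    exact (intF ε hε).integral_prod_left
  -- the swapped form
  have swap : ∀ ε, 0 < ε → ∫ x, (∫ y, f y *
      pds L (fun y' => a ε (x, y') * ((ε ^ n)⁻¹ * φ (ε⁻¹ • (y' - x)))) y) * ψ x =
      ∫ y, f y * ∫ x, G ε (x, y) * ρ ε (x, y) := by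
    intro ε hε
    simp_rw [inner ε hε]
    rw [integral_integral_swap (f := fun x y => f y *
      dds (es.map (fun e => ((0 : Rn n), e))) (H ε) (x, y)) (intF ε hε)]
    congr 1
    funext y
    rw [integral_const_mul, integral_dds_diag y es (sH ε hε) (cH ε hε)]
    simp_rw [diagH ε hε]
  have intS : ∀ ε, 0 < ε → Integrable (fun y => f y * ∫ x, G ε (x, y) * ρ ε (x, y)) := by
    intro ε hε
    have := (intF ε hε).integral_prod_right
    refine this.congr (Eventually.of_forall fun y => ?_)
    simp only
    rw [integral_const_mul, integral_dds_diag y es (sH ε hε) (cH ε hε)]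
    simp_rw [diagH ε hε]
  have intT : Integrable (fun y => f y * (c * pds L ψ y)) := by
    rw [pds_eq_dds]
    exact (hf.mul (continuous_const.mul
      (contDiff_dds hψ _).continuous)).integrable_of_hasCompactSupport
      (hasCompactSupport_dds hψc _).mul_left.mul_left
  set K : Set (Rn n) := (fun p : Rn n × Rn n => p.1 + p.2) ''
      (tsupport ψ ×ˢ Metric.closedBall 0 R) with hK
  have cK : IsCompact K := (hψc.isCompact.prod (isCompact_closedBall _ _)).image (by fun_prop)
  set M := ∫ x, |φ x| with hM
  have hM0 : 0 ≤ M := integral_nonneg fun _ => abs_nonneg _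
  set N := ∫ y in K, |f y| with hN
  have hN0 : 0 ≤ N := integral_nonneg fun _ => abs_nonneg _
  have target : c * ∫ y, f y * pds L ψ y = ∫ y, f y * (c * pds L ψ y) := by
    rw [← integral_const_mul]
    congr 1
    funext y
    ring
  rw [target, Metric.tendsto_nhds]
  intro η' hη'
  have hMN : 0 ≤ M * N := mul_nonneg hM0 hN0
  set η := η' / (M * N + 1) with hηdef
  have hη : 0 < η := by positivity
  have unif : ∀ᶠ ε in 𝓝 (0 : ℝ), ∀ y ∈ K, 0 < ε →
      |(∫ x, G ε (x, y) * ρ ε (x, y)) - c * pds L ψ y| ≤ η * M := by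
    apply cK.eventually_forall_of_forall_eventually
    intro y₀ _
    obtain ⟨δ, hδ, hb⟩ := (lG y₀).equicont sG hη
    rw [Metric.eventually_nhds_iff]
    refine ⟨min (δ / 2) (δ / 2 / R), by positivity, ?_⟩
    rintro ⟨ε, y⟩ hq hε
    simp only at hε ⊢
    rw [Prod.dist_eq, max_lt_iff] at hq
    obtain ⟨hq1, hq2⟩ := hq
    simp only [Real.dist_eq, sub_zero, abs_of_pos hε] at hq1
    have hy : dist y y₀ < δ / 2 := hq2.trans_le (min_le_left _ _)
    have hεR : ε * R < δ / 2 := (lt_div_iff₀ hR1).1 (hq1.trans_le (min_le_right _ _))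
    have hε2 : ε < δ := by
      have := hq1.trans_le (min_le_left _ _)
      linarith
    rw [← diagG ε hε]
    refine approx_bound hφsm.continuous hφ1 hR hε (g := fun x => G ε (x, y))
      ((sG ε hε).continuous.comp (by fun_prop)) y ?_
    intro x hx
    refine hb ε hε hε2 (x, y) (y, y) ?_ ?_
    · rw [Prod.dist_eq, max_lt_iff]
      rw [← dist_eq_norm, dist_comm] at hx
      have := dist_triangle x y y₀
      constructor
      · simp only
        linarith
      · simp only
        linarith
    · rw [Prod.dist_eq, max_lt_iff]
      constructor
      · simp only
        linarith
      · simp only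
        linarith
  have small : ∀ᶠ ε in 𝓝[>] (0 : ℝ), ε < 1 :=
    mem_nhdsWithin_of_mem_nhds (Iio_mem_nhds one_pos)
  filter_upwards [self_mem_nhdsWithin, nhdsWithin_le_nhds unif, small] with ε hε hu hε1
  have hε : 0 < ε := hε
  rw [swap ε hε, Real.dist_eq, ← integral_sub (intS ε hε) intT, ← Real.norm_eq_abs]
  have off : ∀ y, y ∉ K → (∫ x, G ε (x, y) * ρ ε (x, y)) = 0 ∧ c * pds L ψ y = 0 := by
    intro y hy
    constructor
    · have : ∀ x, G ε (x, y) * ρ ε (x, y) = 0 := by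
        intro x
        rw [← diagH ε hε]
        apply image_eq_zero_of_notMem_tsupport
        intro hmem
        obtain ⟨p, ⟨hp1, hp2⟩, hp⟩ := tH ε hε (tsupport_dds _ _ hmem)
        apply hy
        refine ⟨(p.1, ε • p.2), ⟨hp1, ?_⟩, congrArg Prod.snd hp⟩
        rw [mem_closedBall_zero_iff] at hp2 ⊢
        simp only [norm_smul, Real.norm_of_nonneg hε.le]
        nlinarith [norm_nonneg p.2]
      simp [this]
    · rw [pds_eq_dds, image_eq_zero_of_notMem_tsupport (f := dds _ ψ), mul_zero]
      intro hmem
      exact hy ⟨(y, 0), ⟨tsupport_dds _ _ hmem, by simp [hR1.le]⟩, by simp⟩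
  have fin : ‖∫ y, (f y * (∫ x, G ε (x, y) * ρ ε (x, y)) - f y * (c * pds L ψ y))‖ ≤
      ∫ y, K.indicator (fun y => |f y| * (η * M)) y := by
    apply norm_integral_le_of_norm_le
    · rw [integrable_indicator_iff cK.measurableSet]
      exact ContinuousOn.integrableOn_compact cK (by fun_prop)
    · refine Eventually.of_forall fun y => ?_
      by_cases hy : y ∈ K
      · rw [indicator_of_mem hy, ← mul_sub, norm_mul, Real.norm_eq_abs, Real.norm_eq_abs]
        gcongr
        exact hu y hy hε
      · rw [indicator_of_notMem hy, (off y hy).1, (off y hy).2]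
        simp
  refine fin.trans_lt ?_
  rw [integral_indicator cK.measurableSet, integral_mul_const, ← hN]
  have : N * (η * M) = η' * (M * N) / (M * N + 1) := by
    rw [hηdef]; field_simp
  rw [this, div_lt_iff₀ (by positivity)]
  nlinarith

theorem prod_one_entry {n r : ℕ} (i p : Fin r → Fin n) :
    ∏ k, (1 : Matrix (Fin n) (Fin n) ℝ) (i k) (p k) = if i = p then 1 else 0 := by
  split_ifs with h
  · subst h; simp
  · obtain ⟨k, hk⟩ := Function.ne_iff.1 h
    exact Finset.prod_eq_zero (Finset.mem_univ k) (Matrix.one_apply_ne hk)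

/-- The entry functional as a continuous linear map. -/
noncomputable def entryCLM {n : ℕ} (α β : Fin n) : (Fin n → Fin n → ℝ) →L[ℝ] ℝ :=
  (ContinuousLinearMap.proj β : (Fin n → ℝ) →L[ℝ] ℝ).comp
    (ContinuousLinearMap.proj α : (Fin n → Fin n → ℝ) →L[ℝ] (Fin n → ℝ))

theorem contDiff_entry {n : ℕ} (Υ : Rn n → Rn n → Matrix (Fin n) (Fin n) ℝ)
    (h : ContDiff ℝ (⊤ : ℕ∞) (fun p : Rn n × Rn n => Υ p.1 p.2)) (α β : Fin n) :
    ContDiff ℝ (⊤ : ℕ∞) (fun p : Rn n × Rn n => Υ p.1 p.2 α β) :=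
  (entryCLM α β).contDiff.comp h

theorem LB_entry {n : ℕ} (Υ : ℝ → Rn n → Rn n → Matrix (Fin n) (Fin n) ℝ)
    (hΥsm : ∀ ε : ℝ, 0 < ε → ContDiff ℝ (⊤ : ℕ∞) (fun p : Rn n × Rn n => Υ ε p.1 p.2))
    (hΥbd : ∀ K : Set (Rn n), IsCompact K → ∀ k : ℕ,
      ∃ δ > (0:ℝ), ∃ C > (0:ℝ), ∃ ε₀ > (0:ℝ), ∀ ε : ℝ, 0 < ε → ε < ε₀ →
        ∀ x ∈ K, ∀ y : Rn n, ‖y - x‖ < δ →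
          ‖iteratedFDeriv ℝ k (fun p : Rn n × Rn n => Υ ε p.1 p.2) (x, y)‖ ≤ C)
    (α β : Fin n) (x₀ : Rn n) :
    LB (fun ε (p : Rn n × Rn n) => Υ ε p.1 p.2 α β) (x₀, x₀) := by
  intro k
  obtain ⟨δ, hδ, C, hC, ε₀, hε₀, hb⟩ := hΥbd _ (isCompact_closedBall x₀ 1) k
  refine ⟨‖entryCLM α β‖ * C, ?_⟩
  rw [Metric.eventually_nhds_iff]
  refine ⟨min ε₀ (min 1 (δ / 2)), by positivity, ?_⟩
  rintro ⟨ε, x, y⟩ hq hε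
  simp only at hε ⊢
  simp only [Prod.dist_eq, max_lt_iff, lt_min_iff, Real.dist_eq, sub_zero, abs_of_pos hε] at hq
  obtain ⟨⟨h1, -, -⟩, ⟨-, h2, -⟩, ⟨-, h3, h4⟩⟩ := hq
  have hxy : ‖y - x‖ < δ := by
    rw [← dist_eq_norm]
    have := dist_triangle_right y x x₀
    linarith
  have hk := hb ε hε h1 x (Metric.mem_closedBall.2 h2.le) y hxy
  have h5 := (entryCLM α β).norm_iteratedFDeriv_comp_left
    ((hΥsm ε hε).contDiffAt (x := (x, y))) (n := k) (by exact mod_cast (le_top : (k : ℕ∞) ≤ ⊤))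
  exact LE.le.trans h5 (mul_le_mul_of_nonneg_left hk (norm_nonneg (entryCLM α β)))

theorem LB.swap {n : ℕ} {g : ℝ → Rn n × Rn n → ℝ} {x₀ : Rn n} (hg : LB g (x₀, x₀)) :
    LB (fun ε p => g ε (p.2, p.1)) (x₀, x₀) := by
  intro k
  obtain ⟨C, hC⟩ := hg k
  refine ⟨C, ?_⟩
  have ht : Tendsto (fun q : ℝ × (Rn n × Rn n) => (q.1, (q.2.2, q.2.1)))
      (𝓝 ((0 : ℝ), (x₀, x₀))) (𝓝 ((0 : ℝ), (x₀, x₀))) := by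
    have : Continuous (fun q : ℝ × (Rn n × Rn n) => (q.1, (q.2.2, q.2.1))) := by fun_prop
    exact this.tendsto _
  filter_upwards [ht.eventually hC] with q hq hpos
  have := (LinearIsometryEquiv.prodComm ℝ (Rn n) (Rn n)).norm_iteratedFDeriv_comp_right
    (g q.1) q.2 k
  exact (LE.le.trans this.le (hq hpos))

end DeltaNetHelpers

theorem embedding_converges_to_distribution {n r s : ℕ}
    (φ : Rn n → ℝ) (hφsm : ContDiff ℝ (⊤ : ℕ∞) φ) (hφc : HasCompactSupport φ)
    (hφ1 : ∫ y : Rn n, φ y = 1)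
    (Υ : ℝ → Rn n → Rn n → Matrix (Fin n) (Fin n) ℝ)
    (hΥsm : ∀ ε : ℝ, 0 < ε → ContDiff ℝ (⊤ : ℕ∞) (fun p : Rn n × Rn n => Υ ε p.1 p.2))
    (hΥid : ∀ ε : ℝ, 0 < ε → ∀ x, Υ ε x x = 1)
    (hΥbd : ∀ K : Set (Rn n), IsCompact K → ∀ k : ℕ,
      ∃ δ > (0:ℝ), ∃ C > (0:ℝ), ∃ ε₀ > (0:ℝ), ∀ ε : ℝ, 0 < ε → ε < ε₀ →
        ∀ x ∈ K, ∀ y : Rn n, ‖y - x‖ < δ →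
          ‖iteratedFDeriv ℝ k (fun p : Rn n × Rn n => Υ ε p.1 p.2) (x, y)‖ ≤ C)
    (L : List (Fin n))
    (f : Rn n → Tens n r s) (hf : Continuous f)
    (Ψ : Rn n → Tens n s r) (hΨ : ∀ q p, ContDiff ℝ (⊤ : ℕ∞) (fun x => Ψ x q p))
    (hΨc : HasCompactSupport Ψ) :
    Tendsto
      (fun ε => ∫ x : Rn n, ∑ i : Fin r → Fin n, ∑ j : Fin s → Fin n,
        embedDistTens φ Υ L f ε x i j * Ψ x j i)
      (nhdsWithin 0 (Ioi 0))
      (nhds ((-1 : ℝ) ^ L.length *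
        ∫ x : Rn n, ∑ p : Fin r → Fin n, ∑ q : Fin s → Fin n,
          f x p q * pds L (fun x' => Ψ x' q p) x)) := by
  classical
  set A : (Fin r → Fin n) → (Fin s → Fin n) → (Fin r → Fin n) → (Fin s → Fin n) →
      ℝ → Rn n × Rn n → ℝ := fun i j p q ε v =>
    (∏ k : Fin r, Υ ε v.1 v.2 (i k) (p k)) * (∏ k : Fin s, Υ ε v.2 v.1 (q k) (j k)) with hA
  set I : (Fin r → Fin n) → (Fin s → Fin n) → (Fin r → Fin n) → (Fin s → Fin n) →
      ℝ → Rn n → ℝ := fun i j p q ε x =>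
    (∫ y, f y p q * pds L (fun y' => A i j p q ε (x, y') *
      ((ε ^ n)⁻¹ * φ (ε⁻¹ • (y' - x)))) y) * Ψ x j i with hI
  have s1 : ∀ α β ε, 0 < ε →
      ContDiff ℝ (⊤ : ℕ∞) (fun v : Rn n × Rn n => Υ ε v.1 v.2 α β) :=
    fun α β ε hε => contDiff_entry (Υ ε) (hΥsm ε hε) α β
  have s2 : ∀ α β ε, 0 < ε →
      ContDiff ℝ (⊤ : ℕ∞) (fun v : Rn n × Rn n => Υ ε v.2 v.1 α β) := fun α β ε hε =>
    (s1 α β ε hε).comp (contDiff_snd.prodMk contDiff_fst)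
  have hΨcc : ∀ j i, HasCompactSupport (fun x => Ψ x j i) := by
    intro j i
    apply HasCompactSupport.intro hΨc.isCompact
    intro x hx
    rw [image_eq_zero_of_notMem_tsupport hx]
    rfl
  have main := fun i j p q => component_tendsto φ hφsm hφc hφ1 (A i j p q)
    (fun ε hε => (contDiff_prod fun k _ => s1 _ _ ε hε).mul
      (contDiff_prod fun k _ => s2 _ _ ε hε))
    (fun x => (LB.prod Finset.univ (fun k => LB_entry Υ hΥsm hΥbd (i k) (p k) x)
        (fun k => s1 _ _)).mul
      (LB.prod Finset.univ (fun k => (LB_entry Υ hΥsm hΥbd (q k) (j k) x).swap)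
        (fun k => s2 _ _))
      (fun ε hε => contDiff_prod fun k _ => s1 _ _ ε hε)
      (fun ε hε => contDiff_prod fun k _ => s2 _ _ ε hε))
    ((if i = p then 1 else 0) * (if q = j then 1 else 0))
    (fun ε hε x => by
      simp only [hA, hΥid ε hε x]
      rw [prod_one_entry, prod_one_entry])
    L (fun y => f y p q) (by fun_prop) (fun x => Ψ x j i) (hΨ j i) (hΨcc j i)
  have hlim : Tendsto (fun ε => ∑ i, ∑ j, ∑ p, ∑ q, (-1 : ℝ) ^ L.length * ∫ x, I i j p q ε x)
      (𝓝[>] 0) (𝓝 (∑ i, ∑ j, ∑ p, ∑ q, (-1 : ℝ) ^ L.length *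
        (((if i = p then 1 else 0) * (if q = j then 1 else 0)) *
          ∫ y, f y p q * pds L (fun x => Ψ x j i) y))) :=
    tendsto_finsetSum _ fun i _ => tendsto_finsetSum _ fun j _ => tendsto_finsetSum _ fun p _ =>
      tendsto_finsetSum _ fun q _ => (main i j p q).2.const_mul _
  have hval : (∑ i, ∑ j, ∑ p, ∑ q, (-1 : ℝ) ^ L.length *
        (((if i = p then 1 else 0) * (if q = j then 1 else 0)) *
          ∫ y, f y p q * pds L (fun x => Ψ x j i) y)) =
      (-1 : ℝ) ^ L.length * ∫ x : Rn n, ∑ p : Fin r → Fin n, ∑ q : Fin s → Fin n,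
          f x p q * pds L (fun x' => Ψ x' q p) x := by
    have hint : ∀ p q, Integrable (fun x => f x p q * pds L (fun x' => Ψ x' q p) x) := by
      intro p q
      rw [pds_eq_dds]
      have hfc : Continuous (fun x => f x p q) := by fun_prop
      exact (hfc.mul (contDiff_dds (hΨ q p) _).continuous).integrable_of_hasCompactSupport
        (hasCompactSupport_dds (hΨcc q p) _).mul_left
    rw [integral_finsetSum _ fun p _ => integrable_finsetSum _ fun q _ => hint p q]
    simp_rw [integral_finsetSum _ fun q _ => hint _ q]
    simp [ite_mul, Finset.mul_sum, Finset.sum_ite_eq]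
  rw [← hval]
  refine hlim.congr' ?_
  filter_upwards [self_mem_nhdsWithin] with ε hε
  have hε : 0 < ε := hε
  have hIi : ∀ i j p q, Integrable (fun x => (-1 : ℝ) ^ L.length * I i j p q ε x) :=
    fun i j p q => ((main i j p q).1 ε hε).const_mul _
  have hpt : ∀ x, (∑ i : Fin r → Fin n, ∑ j : Fin s → Fin n,
        embedDistTens φ Υ L f ε x i j * Ψ x j i) =
      ∑ i, ∑ j, ∑ p, ∑ q, (-1 : ℝ) ^ L.length * I i j p q ε x := by
    intro x
    refine Finset.sum_congr rfl fun i _ => Finset.sum_congr rfl fun j _ => ?_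
    simp only [embedDistTens, hI, hA, Finset.mul_sum, Finset.sum_mul, mul_assoc]
  simp_rw [hpt]
  rw [integral_finsetSum _ fun i _ => integrable_finsetSum _ fun j _ =>
    integrable_finsetSum _ fun p _ => integrable_finsetSum _ fun q _ => hIi i j p q]
  refine Finset.sum_congr rfl fun i _ => ?_
  rw [integral_finsetSum _ fun j _ =>
    integrable_finsetSum _ fun p _ => integrable_finsetSum _ fun q _ => hIi i j p q]
  refine Finset.sum_congr rfl fun j _ => ?_
  rw [integral_finsetSum _ fun p _ => integrable_finsetSum _ fun q _ => hIi i j p q]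
  refine Finset.sum_congr rfl fun p _ => ?_
  rw [integral_finsetSum _ fun q _ => hIi i j p q]
  refine Finset.sum_congr rfl fun q _ => ?_
  rw [integral_const_mul]
end
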